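/- arXiv:1910.00369 — 4 statements merged into one kernel-verified Lean document; each statement's English description precedes it below -/
import Mathlib

section
/- Let 0 < η < 1 and let u, x ∈ ℝ with x ≠ u. Then the two-sided Marchaud derivative with respect to the parameter t of the family of Heaviside functions t ↦ H_t(x), evaluated at t = u, equals −(1/(2Γ(1−η))) · |x − u|^{−η}; that is, (Γ_η/2) ∫_{−∞}^∞ (H_{u+t}(x) − H_u(x)) sign(t) |t|^{−1−η} dt = −(1/(2Γ(1−η))) |x−u|^{−η}. -/
open MeasureTheory

/-- The Heaviside jump at `u`: `−1` for `x < u`, `0` for `x > u`, and `−1/2` at `x = u`. -/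
noncomputable def heaviside (u x : ℝ) : ℝ := if x < u then -1 else if u < x then 0 else -1/2

theorem heaviside_add_sub_mul_sign_ae_eq_of_lt {u x : ℝ} (h : u < x) (s : ℝ) :
    (fun t : ℝ => (heaviside (u + t) x - heaviside u x) * Real.sign t * |t| ^ s) =ᵐ[volume]
      (Set.Ioi (x - u)).indicator fun t => -t ^ s := by
  filter_upwards [Measure.ae_ne volume (x - u)] with t ht
  rcases lt_or_gt_of_ne ht with h1 | h1
  · have h2 : u + t < x := by linarith
    simp [heaviside, h.not_gt, h, h2, h2.not_gt, h1.le]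
  · have h2 : x < u + t := by linarith
    have h3 : 0 < t := by linarith
    simp [heaviside, h.not_gt, h, h2, h1, Real.sign_of_pos h3, abs_of_pos h3]

theorem heaviside_add_sub_mul_sign_ae_eq_of_gt {u x : ℝ} (h : x < u) (s : ℝ) :
    (fun t : ℝ => (heaviside (u + t) x - heaviside u x) * Real.sign t * |t| ^ s) =ᵐ[volume]
      (Set.Iic (x - u)).indicator fun t => -(-t) ^ s := by
  filter_upwards [Measure.ae_ne volume (x - u)] with t ht
  rcases lt_or_gt_of_ne ht with h1 | h1
  · have h2 : u + t < x := by linarith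
    have h3 : t < 0 := by linarith
    simp [heaviside, h, h2, h2.not_gt, h1.le, Real.sign_of_neg h3, abs_of_neg h3]
  · have h2 : x < u + t := by linarith
    simp [heaviside, h, h2, h1]

theorem integral_heaviside_add_sub_mul_sign {u x s : ℝ} (hxu : x ≠ u) (hs : s < -1) :
    ∫ t : ℝ, (heaviside (u + t) x - heaviside u x) * Real.sign t * |t| ^ s
      = |x - u| ^ (s + 1) / (s + 1) := by
  rcases lt_or_gt_of_ne hxu with h | h
  · rw [integral_congr_ae (heaviside_add_sub_mul_sign_ae_eq_of_gt h s),
      integral_indicator measurableSet_Iic, integral_comp_neg_Iic (x - u) fun t => -t ^ s,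
      integral_neg, integral_Ioi_rpow_of_lt hs (by linarith), abs_of_neg (by linarith)]
    ring
  · rw [integral_congr_ae (heaviside_add_sub_mul_sign_ae_eq_of_lt h s),
      integral_indicator measurableSet_Ioi,
      integral_neg, integral_Ioi_rpow_of_lt hs (by linarith), abs_of_pos (by linarith)]
    ring

/-- For `0 < η < 1` and `x ≠ u`, the two-sided Marchaud derivative in the
parameter `t` of `t ↦ H_t(x)` at `t = u` equals `−(1/(2Γ(1−η))) |x−u|^{−η}`. -/
theorem marchaud_param_heaviside (η u x : ℝ) (hη0 : 0 < η) (hη1 : η < 1) (hxu : x ≠ u) :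
    η / Real.Gamma (1 - η) / 2 *
      (∫ t : ℝ, (heaviside (u + t) x - heaviside u x) * Real.sign t * |t| ^ (-1 - η))
    = -(1 / (2 * Real.Gamma (1 - η))) * |x - u| ^ (-η) := by
  rw [integral_heaviside_add_sub_mul_sign hxu (by linarith), show -1 - η + 1 = -η by ring]
  have hΓ : Real.Gamma (1 - η) ≠ 0 := (Real.Gamma_pos_of_pos (by linarith)).ne'
  field_simp
end

section
/- Let 0 < η < 1 and let u, x ∈ ℝ with x ≠ u. Then the two-sided Marchaud derivative with respect to the space variable y of the Heaviside function y ↦ H_u(y), evaluated at y = x, equals +(1/(2Γ(1−η))) · |x − u|^{−η}; equivalently, M^η_y H_u(y)|_{y=x} = − M^η_t H_t(x)|_{t=u}, where M^η_t H_t(x)|_{t=u} = −(1/(2Γ(1−η)))|x−u|^{−η}. -/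
open MeasureTheory

theorem heaviside_add_left (u t x : ℝ) : heaviside (u + t) x = heaviside u (x - t) := by
  simp only [heaviside, lt_sub_iff_add_lt, sub_lt_iff_lt_add]

theorem integral_eq_of_eq_ite {η d : ℝ} (hη : 0 < η) (hd : 0 < d) {f : ℝ → ℝ}
    (hf : ∀ t, t ≠ d → f t = if d < t then t ^ (-1 - η) else 0) :
    ∫ t, f t = d ^ (-η) / η := by
  have h : f =ᵐ[volume] (Set.Ioi d).indicator (fun t => t ^ (-1 - η)) := by
    filter_upwards [Measure.ae_ne volume d] with t ht
    simp only [hf t ht, Set.indicator_apply, Set.mem_Ioi]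
  rw [integral_congr_ae h, integral_indicator measurableSet_Ioi,
    integral_Ioi_rpow_of_lt (by linarith) hd, show -1 - η + 1 = -η by ring, neg_div_neg_eq]

theorem integral_heaviside_space {η u x : ℝ} (hη : 0 < η) (hxu : x ≠ u) :
    ∫ t : ℝ, (heaviside u (x + t) - heaviside u x) * Real.sign t * |t| ^ (-1 - η)
      = |x - u| ^ (-η) / η := by
  have hd : 0 < |x - u| := abs_pos.2 (sub_ne_zero.2 hxu)
  rcases hxu.lt_or_gt with h | h
  · refine integral_eq_of_eq_ite hη hd fun t ht => ?_
    rw [abs_of_neg (sub_neg.2 h)] at ht ⊢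
    rcases ht.lt_or_gt with h' | h'
    · rw [if_neg h'.not_gt, heaviside, heaviside, if_pos h, if_pos (by linarith)]
      ring
    · have ht0 : 0 < t := by linarith
      rw [if_pos h', Real.sign_of_pos ht0, abs_of_pos ht0, heaviside, heaviside, if_pos h,
        if_neg (by linarith), if_pos (by linarith)]
      ring
  · rw [← integral_neg_eq_self]
    refine integral_eq_of_eq_ite hη hd fun t ht => ?_
    rw [abs_of_pos (sub_pos.2 h)] at ht ⊢
    rcases ht.lt_or_gt with h' | h'
    · rw [if_neg h'.not_gt, heaviside, heaviside, if_neg h.not_gt, if_pos h,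
        if_neg (by linarith), if_pos (by linarith)]
      ring
    · have ht0 : 0 < t := by linarith
      rw [if_pos h', Real.sign_of_neg (by linarith), abs_neg, abs_of_pos ht0, heaviside, heaviside,
        if_neg h.not_gt, if_pos h, if_pos (by linarith)]
      ring

theorem integral_heaviside_param (η u x : ℝ) :
    ∫ t : ℝ, (heaviside (u + t) x - heaviside u x) * Real.sign t * |t| ^ (-1 - η)
      = -∫ t : ℝ, (heaviside u (x + t) - heaviside u x) * Real.sign t * |t| ^ (-1 - η) := by
  rw [← integral_neg_eq_self, ← integral_neg]
  congr 1 with t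
  rw [heaviside_add_left, sub_neg_eq_add, Real.sign_neg, abs_neg]
  ring

/-- For `0 < η < 1` and `x ≠ u`, the two-sided Marchaud derivative in the
space variable `y` of `y ↦ H_u(y)` at `y = x` equals `+(1/(2Γ(1−η))) |x−u|^{−η}`;
equivalently it is the negative of the Marchaud derivative in the parameter. -/
theorem marchaud_space_heaviside (η u x : ℝ) (hη0 : 0 < η) (hη1 : η < 1) (hxu : x ≠ u) :
    (η / Real.Gamma (1 - η) / 2 *
        (∫ t : ℝ, (heaviside u (x + t) - heaviside u x) * Real.sign t * |t| ^ (-1 - η))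
      = 1 / (2 * Real.Gamma (1 - η)) * |x - u| ^ (-η)) ∧
    (η / Real.Gamma (1 - η) / 2 *
        (∫ t : ℝ, (heaviside u (x + t) - heaviside u x) * Real.sign t * |t| ^ (-1 - η))
      = -(η / Real.Gamma (1 - η) / 2 *
          (∫ t : ℝ, (heaviside (u + t) x - heaviside u x) * Real.sign t * |t| ^ (-1 - η)))) := by
  refine ⟨?_, ?_⟩
  · have hΓ : Real.Gamma (1 - η) ≠ 0 := (Real.Gamma_pos_of_pos (by linarith)).ne'
    rw [integral_heaviside_space hη0 hxu]
    field_simp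
  · rw [integral_heaviside_param]
    ring
end

section
/- Let λ_0 ∈ (1,2) and for t ∈ ℝ with |t| < min(2 − λ_0, λ_0 − 1), set λ_t = λ_0 + t and define the tent map f̄_t : [−1,1] → ℝ by f̄_t(x) = λ_t x + λ_t − 1 for −1 ≤ x ≤ 0 and f̄_t(x) = −λ_t x + λ_t − 1 for 0 ≤ x ≤ 1. Define the transfer operator by (L̄_t φ)(x) = λ_t^{−1} ∑_{y ∈ [−1,1] : f̄_t(y) = x} φ(y) for functions φ : [−1,1] → ℂ (the sum over the empty set being 0). Then for every such t, every φ, and every x ∈ ℝ: (L̄_t φ)(x) = (λ_0/λ_t) · (L̄_0 φ)((λ_0 x − t)/λ_t). -/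
/-- The tent map with slope `lam`: `x ↦ lam·x + lam − 1` on `[−1,0]` and
`x ↦ −lam·x + lam − 1` on `[0,1]`. -/
noncomputable def tentBar (lam x : ℝ) : ℝ :=
  if x ≤ 0 then lam * x + lam - 1 else -lam * x + lam - 1

/-- The transfer operator of the tent map with slope `lam`:
`(L φ)(x) = lam⁻¹ ∑_{y ∈ [−1,1], f(y) = x} φ(y)`. -/
noncomputable def transferBar (lam : ℝ) (φ : ℝ → ℂ) (x : ℝ) : ℂ :=
  (lam : ℂ)⁻¹ * ∑ᶠ y ∈ {y : ℝ | y ∈ Set.Icc (-1 : ℝ) 1 ∧ tentBar lam y = x}, φ y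

theorem tentBar_add_one (lam x : ℝ) : tentBar lam x + 1 = lam * (1 - |x|) := by
  unfold tentBar
  split_ifs with h
  · rw [abs_of_nonpos h]; ring
  · rw [abs_of_pos (not_le.mp h)]; ring

theorem tentBar_eq_iff {lam : ℝ} (hlam : lam ≠ 0) (x y : ℝ) :
    tentBar lam y = x ↔ 1 - |y| = (x + 1) / lam := by
  rw [← add_left_inj (1 : ℝ), tentBar_add_one, eq_div_iff hlam, mul_comm]

/-- For the family of tent maps `f̄_t` with slopes `λ_t = λ_0 + t`, the transfer
operators satisfy `(L̄_t φ)(x) = (λ_0/λ_t) (L̄_0 φ)((λ_0 x − t)/λ_t)`. -/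
theorem transferBar_conjugation (lam0 t : ℝ) (h1 : 1 < lam0) (h2 : lam0 < 2)
    (ht : |t| < min (2 - lam0) (lam0 - 1)) (φ : ℝ → ℂ) (x : ℝ) :
    transferBar (lam0 + t) φ x
      = ((lam0 / (lam0 + t) : ℝ) : ℂ) *
          transferBar lam0 φ ((lam0 * x - t) / (lam0 + t)) := by
  have hpos : 0 < lam0 + t := by
    linarith [neg_abs_le t, ht.trans_le (min_le_right _ _)]
  have h0 : lam0 ≠ 0 := by positivity
  have hpre (y : ℝ) : tentBar (lam0 + t) y = x ↔
      tentBar lam0 y = (lam0 * x - t) / (lam0 + t) := by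
    have hne := hpos.ne'
    rw [tentBar_eq_iff hne, tentBar_eq_iff h0,
      show ((lam0 * x - t) / (lam0 + t) + 1) / lam0 = (x + 1) / (lam0 + t) by
        field_simp; ring]
  have hcoef : ((lam0 / (lam0 + t) : ℝ) : ℂ) * (lam0 : ℂ)⁻¹ = ((lam0 + t : ℝ) : ℂ)⁻¹ := by
    rw [Complex.ofReal_div, div_mul_eq_mul_div,
      mul_inv_cancel₀ (Complex.ofReal_ne_zero.mpr h0), one_div]
  simp only [transferBar, hpre]
  rw [← mul_assoc, hcoef]
end

section
/- Let 0 < η < 1, ε > 0, u ∈ ℝ, and x ∈ ℝ with x ≠ u. Then the truncated two-sided Marchaud derivative of the function y ↦ y·H_u(y) at x satisfies the decomposition M^{η,(ε)}(y ↦ y H_u(y))(x) = (Γ_η/2) ∫_{−ε}^{ε} H_{u−x}(y) |y|^{−η} dy + x · M^{η,(ε)}(H_u)(x), all integrals involved being absolutely convergent. -/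
open MeasureTheory

lemma heaviside_add (u x y : ℝ) : heaviside u (x + y) = heaviside (u - x) y := by
  simp only [heaviside, lt_sub_iff_add_lt', sub_lt_iff_lt_add']

lemma measurable_heaviside (u : ℝ) : Measurable (heaviside u) :=
  Measurable.ite measurableSet_Iio measurable_const
    (Measurable.ite measurableSet_Ioi measurable_const measurable_const)

lemma abs_heaviside_le_one (u x : ℝ) : |heaviside u x| ≤ 1 := by
  unfold heaviside
  split_ifs <;> norm_num [abs_le]

lemma abs_heaviside_sub_le_one (u x y : ℝ) : |heaviside u x - heaviside u y| ≤ 1 := by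
  unfold heaviside
  split_ifs <;> norm_num [abs_le]

lemma heaviside_add_eq_of_abs_lt {u x y : ℝ} (h : |y| < |u - x|) :
    heaviside u (x + y) = heaviside u x := by
  obtain ⟨h₁, h₂⟩ := abs_lt.1 h
  rcases le_total 0 (u - x) with hu | hu
  · rw [abs_of_nonneg hu] at h₁ h₂
    simp only [heaviside, if_pos (show x + y < u by linarith), if_pos (show x < u by linarith)]
  · rw [abs_of_nonpos hu] at h₁ h₂
    simp only [heaviside, if_neg (show ¬ x + y < u by linarith), if_neg (show ¬ x < u by linarith),
      if_pos (show u < x + y by linarith), if_pos (show u < x by linarith)]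

lemma measurable_real_sign : Measurable Real.sign :=
  Measurable.ite measurableSet_Iio measurable_const
    (Measurable.ite measurableSet_Ioi measurable_const measurable_const)

lemma abs_real_sign_le_one (y : ℝ) : |Real.sign y| ≤ 1 := by
  rcases Real.sign_apply_eq y with h | h | h <;> simp [h]

lemma integrableOn_abs_rpow {r : ℝ} (hr : -1 < r) {a : ℝ} (ha : 0 < a) :
    IntegrableOn (fun y : ℝ => |y| ^ r) (Set.Ioo (-a) a) volume := by
  have hpos : IntervalIntegrable (fun y : ℝ => |y| ^ r) volume 0 a := by
    refine (intervalIntegral.intervalIntegrable_rpow' (a := 0) (b := a) hr).congr ?_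
    intro y hy
    rw [Set.uIoc_of_le ha.le] at hy
    simp only [abs_of_pos hy.1]
  have hneg : IntervalIntegrable (fun y : ℝ => |y| ^ r) volume (-a) 0 := by
    simpa using ((IntervalIntegrable.iff_comp_neg).1 hpos).symm
  exact ((intervalIntegrable_iff_integrableOn_Ioo_of_le (by linarith)).1 (hneg.trans hpos))

lemma mul_sign_mul_abs_rpow {η : ℝ} (hη : η ≠ 0) (y : ℝ) :
    y * Real.sign y * |y| ^ (-1 - η) = |y| ^ (-η) := by
  rcases eq_or_ne y 0 with rfl | hy
  · simp [Real.zero_rpow (neg_ne_zero.2 hη)]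
  · have hs : y * Real.sign y = |y| := by
      rcases hy.lt_or_gt with h | h
      · simp [Real.sign_of_neg h, abs_of_neg h]
      · simp [Real.sign_of_pos h, abs_of_pos h]
    rw [hs, ← Real.rpow_one_add' (abs_nonneg y) (by ring_nf; exact neg_ne_zero.2 hη)]
    congr 1
    ring

lemma norm_heaviside_sub_mul_le {u x : ℝ} (hxu : x ≠ u) (η y : ℝ) :
    ‖(heaviside u (x + y) - heaviside u x) * Real.sign y * |y| ^ (-1 - η)‖
      ≤ |u - x|⁻¹ * |y| ^ (-η) := by
  have hd : 0 < |u - x| := abs_pos.2 (sub_ne_zero.2 hxu.symm)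
  rcases lt_or_ge |y| |u - x| with h | h
  · rw [heaviside_add_eq_of_abs_lt h, sub_self, zero_mul, zero_mul, norm_zero]
    positivity
  · have hy : 0 < |y| := hd.trans_le h
    have hp : |y| ^ (-1 - η) = |y|⁻¹ * |y| ^ (-η) := by
      rw [sub_eq_add_neg, Real.rpow_add hy, Real.rpow_neg_one]
    rw [norm_mul, norm_mul, Real.norm_eq_abs, Real.norm_eq_abs, Real.norm_eq_abs,
      abs_of_nonneg (Real.rpow_nonneg (abs_nonneg y) _), hp]
    calc _ ≤ 1 * 1 * (|y|⁻¹ * |y| ^ (-η)) := by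
          gcongr
          · exact abs_heaviside_sub_le_one _ _ _
          · exact abs_real_sign_le_one y
      _ ≤ |u - x|⁻¹ * |y| ^ (-η) := by
          rw [one_mul, one_mul]
          gcongr

/-- For `0 < η < 1`, `ε > 0`, `x ≠ u`, the truncated Marchaud derivative of
`y ↦ y·H_u(y)` at `x` decomposes as
`(Γ_η/2) ∫_{−ε}^{ε} H_{u−x}(y) |y|^{−η} dy + x · M^{η,(ε)}(H_u)(x)`,
all integrals being absolutely convergent. -/
theorem truncated_marchaud_x_heaviside (η ε u x : ℝ) (hη0 : 0 < η) (hη1 : η < 1)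
    (hε : 0 < ε) (hxu : x ≠ u) :
    IntegrableOn
      (fun y : ℝ =>
        ((x + y) * heaviside u (x + y) - x * heaviside u x) * Real.sign y * |y| ^ (-1 - η))
      (Set.Ioo (-ε) ε) volume ∧
    IntegrableOn (fun y : ℝ => heaviside (u - x) y * |y| ^ (-η)) (Set.Ioo (-ε) ε) volume ∧
    IntegrableOn
      (fun y : ℝ => (heaviside u (x + y) - heaviside u x) * Real.sign y * |y| ^ (-1 - η))
      (Set.Ioo (-ε) ε) volume ∧
    η / Real.Gamma (1 - η) / 2 *
        (∫ y in Set.Ioo (-ε) ε,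
          ((x + y) * heaviside u (x + y) - x * heaviside u x) * Real.sign y * |y| ^ (-1 - η))
      = η / Real.Gamma (1 - η) / 2 *
          (∫ y in Set.Ioo (-ε) ε, heaviside (u - x) y * |y| ^ (-η))
        + x * (η / Real.Gamma (1 - η) / 2 *
            (∫ y in Set.Ioo (-ε) ε,
              (heaviside u (x + y) - heaviside u x) * Real.sign y * |y| ^ (-1 - η))) := by
  have hint := integrableOn_abs_rpow (r := -η) (by linarith) hε
  have hH : IntegrableOn (fun y : ℝ => heaviside (u - x) y * |y| ^ (-η))
      (Set.Ioo (-ε) ε) volume :=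
    hint.bdd_mul (c := 1) (measurable_heaviside _).aestronglyMeasurable
      (Filter.Eventually.of_forall fun y => abs_heaviside_le_one _ y)
  have hM : IntegrableOn
      (fun y : ℝ => (heaviside u (x + y) - heaviside u x) * Real.sign y * |y| ^ (-1 - η))
      (Set.Ioo (-ε) ε) volume := by
    refine (hint.const_mul |u - x|⁻¹).mono' (Measurable.aestronglyMeasurable ?_)
      (Filter.Eventually.of_forall fun y => norm_heaviside_sub_mul_le hxu η y)
    exact ((((measurable_heaviside u).comp (measurable_const_add x)).sub_const _).mul
      measurable_real_sign).mul (measurable_id.abs.pow_const _)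
  have hsplit : (fun y : ℝ =>
      ((x + y) * heaviside u (x + y) - x * heaviside u x) * Real.sign y * |y| ^ (-1 - η))
      = fun y => heaviside (u - x) y * |y| ^ (-η) +
        x * ((heaviside u (x + y) - heaviside u x) * Real.sign y * |y| ^ (-1 - η)) := by
    funext y
    rw [← mul_sign_mul_abs_rpow hη0.ne' y, ← heaviside_add]
    ring
  rw [hsplit]
  refine ⟨hH.add (hM.const_mul x), hH, hM, ?_⟩
  rw [integral_add hH (hM.const_mul x), integral_const_mul]
  ring
end
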